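/- Let K be a fractal square of order n with digit set D containing all four corner digits (0,0), (n−1,0), (0,n−1), (n−1,n−1). If moreover D ∩ (D + (1,0)) ≠ ∅ or D ∩ (D + (0,1)) ≠ ∅ (i.e., some pair of digits is adjacent horizontally or vertically), then K is not a dendrite. -/

import Mathlib

open Set Pointwise

noncomputable section

/-- The canonical embedding of `ℤ × ℤ` into `ℝ × ℝ`. -/
def coeZ2 (d : ℤ × ℤ) : ℝ × ℝ := ((d.1 : ℝ), (d.2 : ℝ))

/-- The contraction similarity `x ↦ (x + d) / n` of the plane. -/
def pieceMap (n : ℕ) (d : ℤ × ℤ) (x : ℝ × ℝ) : ℝ × ℝ := (n : ℝ)⁻¹ • (x + coeZ2 d)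

/-- `K` is a fractal square of order `n` with digit set `D ⊆ {0,…,n-1}²`,
`1 < |D| < n²`: a nonempty compact set with `K = (K + D)/n`. -/
def IsFractalSquare (n : ℕ) (D : Set (ℤ × ℤ)) (K : Set (ℝ × ℝ)) : Prop :=
  2 ≤ n ∧ D ⊆ Set.Icc (0, 0) ((n : ℤ) - 1, (n : ℤ) - 1) ∧
  1 < Nat.card D ∧ Nat.card D < n ^ 2 ∧
  K.Nonempty ∧ IsCompact K ∧
  K = ⋃ d ∈ D, pieceMap n d '' K

/-- A dendrite: a nonempty compact, connected, locally connected (planar) set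
containing no subset homeomorphic to the circle. -/
def IsDendrite (K : Set (ℝ × ℝ)) : Prop :=
  K.Nonempty ∧ IsCompact K ∧ IsConnected K ∧ LocallyConnectedSpace K ∧
  ¬ ∃ S : Set (ℝ × ℝ), S ⊆ K ∧ Nonempty (S ≃ₜ Circle)


/-- A closed subset of the parameter interval all of whose gaps have endpoints with equal image. -/
def ArcValid {X : Type*} (f : ℝ → X) (A : Set ℝ) : Prop :=
  IsClosed A ∧ A ⊆ Icc 0 1 ∧ (0 : ℝ) ∈ A ∧ (1 : ℝ) ∈ A ∧
    ∀ a ∈ A, ∀ b ∈ A, a < b → (∀ z ∈ A, ¬ (a < z ∧ z < b)) → f a = f b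

lemma arcValid_Icc {X : Type*} (f : ℝ → X) : ArcValid f (Icc 0 1) := by
  refine ⟨isClosed_Icc, subset_rfl, by simp, by simp, ?_⟩
  intro a ha b hb hab h
  exfalso
  refine h ((a + b) / 2) ⟨?_, ?_⟩ ⟨?_, ?_⟩ <;> linarith [ha.1, ha.2, hb.1, hb.2]

lemma arcValid_sInter {X : Type*} [MetricSpace X] (f : ℝ → X) (hf : Continuous f)
    (c : Set (Set ℝ)) (hc : ∀ A ∈ c, ArcValid f A) (hch : IsChain (· ⊆ ·) c) (hne : c.Nonempty) :
    ArcValid f (⋂₀ c) := by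
  obtain ⟨A₀, hA₀⟩ := hne
  refine ⟨isClosed_sInter fun A hA => (hc A hA).1, ?_, ?_, ?_, ?_⟩
  · exact (sInter_subset_of_mem hA₀).trans (hc A₀ hA₀).2.1
  · exact mem_sInter.2 fun A hA => (hc A hA).2.2.1
  · exact mem_sInter.2 fun A hA => (hc A hA).2.2.2.1
  intro a ha b hb hab hgap
  by_contra hne
  have hpos : 0 < dist (f a) (f b) / 2 := half_pos (dist_pos.2 hne)
  obtain ⟨δ₁, hδ₁, h₁⟩ := Metric.continuous_iff.1 hf a _ hpos
  obtain ⟨δ₂, hδ₂, h₂⟩ := Metric.continuous_iff.1 hf b _ hpos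
  obtain ⟨δ, hδ, hδ1, hδ2, hδ3⟩ : ∃ δ > 0, δ ≤ δ₁ ∧ δ ≤ δ₂ ∧ δ ≤ (b - a) / 3 :=
    ⟨min δ₁ (min δ₂ ((b - a) / 3)), by
      refine lt_min hδ₁ (lt_min hδ₂ ?_); linarith, by simp, by simp, by simp⟩
  have hC : ∃ C ∈ c, Icc (a + δ) (b - δ) ∩ C = ∅ := by
    have : Nonempty c := ⟨⟨A₀, hA₀⟩⟩
    have := (isCompact_Icc (a := a + δ) (b := b - δ)).elim_directed_family_closed
      (fun A : c => (A : Set ℝ)) (fun A => (hc A A.2).1) ?_ ?_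
    · obtain ⟨C, hC⟩ := this
      exact ⟨C, C.2, hC⟩
    · rw [← sInter_eq_iInter, eq_empty_iff_forall_notMem]
      rintro z ⟨hz1, hz2⟩
      exact hgap z hz2 ⟨by linarith [hz1.1], by linarith [hz1.2]⟩
    · intro A B
      rcases hch.total A.2 B.2 with h | h
      · exact ⟨A, subset_rfl, h⟩
      · exact ⟨B, h, subset_rfl⟩
  obtain ⟨C, hCc, hCe⟩ := hC
  have hCv := hc C hCc
  have haC : a ∈ C := ha C hCc
  have hbC : b ∈ C := hb C hCc
  have hnot : ∀ z ∈ C, a + δ ≤ z → z ≤ b - δ → False := fun z hz h1 h2 =>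
    (eq_empty_iff_forall_notMem.1 hCe) z ⟨⟨h1, h2⟩, hz⟩
  obtain ⟨a', ⟨ha'C, ha'1, ha'2⟩, ha'max⟩ :=
    (isCompact_Icc.inter_left hCv.1 : IsCompact (C ∩ Icc a ((a + b) / 2))).exists_isGreatest
      ⟨a, haC, le_rfl, by linarith⟩
  obtain ⟨b', ⟨hb'C, hb'1, hb'2⟩, hb'min⟩ :=
    (isCompact_Icc.inter_left hCv.1 : IsCompact (C ∩ Icc ((a + b) / 2) b)).exists_isLeast
      ⟨b, hbC, by linarith, le_rfl⟩
  have ha'3 : a' < a + δ := by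
    by_contra h
    exact hnot a' ha'C (not_lt.1 h) (by linarith)
  have hb'3 : b - δ < b' := by
    by_contra h
    exact hnot b' hb'C (by linarith) (not_lt.1 h)
  have heq : f a' = f b' := by
    refine hCv.2.2.2.2 a' ha'C b' hb'C (by linarith) ?_
    rintro z hz ⟨h1, h2⟩
    rcases le_total z ((a + b) / 2) with h | h
    · exact absurd (ha'max ⟨hz, by linarith, h⟩) (not_le.2 h1)
    · exact absurd (hb'min ⟨hz, h, by linarith⟩) (not_le.2 h2)
  have e1 := h₁ a' (by rw [Real.dist_eq, abs_lt]; constructor <;> linarith)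
  have e2 := h₂ b' (by rw [Real.dist_eq, abs_lt]; constructor <;> linarith)
  rw [heq] at e1
  have := dist_triangle_left (f a) (f b) (f b')
  linarith

lemma exists_minimal_arcValid {X : Type*} [MetricSpace X] (f : ℝ → X) (hf : Continuous f) :
    ∃ A, ArcValid f A ∧
      ∀ x ∈ A, ∀ y ∈ A, x < y → f x = f y → ∀ z ∈ A, ¬ (x < z ∧ z < y) := by
  obtain ⟨A, hA⟩ := zorn_superset {A | ArcValid f A} (by
    intro c hc hch
    rcases c.eq_empty_or_nonempty with rfl | hne
    · exact ⟨Icc 0 1, arcValid_Icc f, by simp⟩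
    · exact ⟨⋂₀ c, arcValid_sInter f hf c hc hch hne, fun s hs => sInter_subset_of_mem hs⟩)
  have hAv : ArcValid f A := hA.prop
  refine ⟨A, hAv, ?_⟩
  rintro x hx y hy hxy hfxy z hz ⟨hxz, hzy⟩
  have hv : ArcValid f (A \ Ioo x y) := by
    refine ⟨hAv.1.sdiff isOpen_Ioo, sdiff_subset.trans hAv.2.1, ?_, ?_, ?_⟩
    · exact ⟨hAv.2.2.1, fun h => absurd h.1 (not_lt.2 (hAv.2.1 hx).1)⟩
    · exact ⟨hAv.2.2.2.1, fun h => absurd h.2 (not_lt.2 (hAv.2.1 hy).2)⟩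
    rintro a ⟨haA, ha⟩ b ⟨hbA, hb⟩ hab hgap
    by_cases hex : ∃ w ∈ A, a < w ∧ w < b
    · obtain ⟨w, hwA, haw, hwb⟩ := hex
      have hw : w ∈ Ioo x y := by
        by_contra h
        exact hgap w ⟨hwA, h⟩ ⟨haw, hwb⟩
      have h1 := hgap x ⟨hx, fun h => lt_irrefl _ h.1⟩
      have h2 := hgap y ⟨hy, fun h => lt_irrefl _ h.2⟩
      obtain ⟨hw1, hw2⟩ := hw
      have hxa : x ≤ a := by
        by_contra h
        exact h1 ⟨not_le.1 h, by linarith⟩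
      have hby : b ≤ y := by
        by_contra h
        exact h2 ⟨by linarith, not_le.1 h⟩
      have e1 : x = a := by
        by_contra h
        exact ha ⟨lt_of_le_of_ne hxa h, by linarith⟩
      have e2 : b = y := by
        by_contra h
        exact hb ⟨by linarith, lt_of_le_of_ne hby h⟩
      rw [← e1, e2, hfxy]
    · push Not at hex
      exact hAv.2.2.2.2 a haA b hbA hab fun z hz h => absurd h.2 (not_lt.2 (hex z hz h.1))
  exact (hA.le_of_le hv sdiff_subset hz).2 ⟨hxz, hzy⟩

/-- Every path can be thinned to a path with connected fibres. -/
lemma exists_monotone_path {X : Type*} [MetricSpace X] (f : ℝ → X) (hf : Continuous f) :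
    ∃ g : unitInterval → X, Continuous g ∧ g 0 = f 0 ∧ g 1 = f 1 ∧ range g ⊆ f '' Icc 0 1 ∧
      ∀ s t, s ≤ t → g s = g t → ∀ r, s ≤ r → r ≤ t → g r = g s := by
  obtain ⟨A, hAv, hmin⟩ := exists_minimal_arcValid f hf
  obtain ⟨hcl, hsub, h0, h1, hgap⟩ := hAv
  have hm : ∀ t : unitInterval, ∃ m, IsGreatest (A ∩ Icc 0 (t : ℝ)) m := fun t =>
    (isCompact_Icc.inter_left hcl : IsCompact (A ∩ Icc 0 (t : ℝ))).exists_isGreatest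
      ⟨0, h0, le_rfl, t.2.1⟩
  have hM : ∀ t : unitInterval, ∃ m, IsLeast (A ∩ Icc (t : ℝ) 1) m := fun t =>
    (isCompact_Icc.inter_left hcl : IsCompact (A ∩ Icc (t : ℝ) 1)).exists_isLeast
      ⟨1, h1, t.2.2, le_rfl⟩
  choose m hm using hm
  choose M hM using hM
  have hmM : ∀ t, f (m t) = f (M t) := by
    intro t
    rcases lt_or_ge (m t) (M t) with h | h
    · refine hgap _ (hm t).1.1 _ (hM t).1.1 h ?_
      rintro z hz ⟨hz1, hz2⟩
      rcases le_total z t with h | h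
      · exact absurd ((hm t).2 ⟨hz, (hsub hz).1, h⟩) (not_le.2 hz1)
      · exact absurd ((hM t).2 ⟨hz, h, (hsub hz).2⟩) (not_le.2 hz2)
    · have := (hm t).1.2.2
      have := (hM t).1.2.1
      rw [show m t = M t by linarith]
  have hmono : ∀ s t, s ≤ t → m s ≤ m t := fun s t hst =>
    (hm t).2 ⟨(hm s).1.1, (hm s).1.2.1, (hm s).1.2.2.trans hst⟩
  have key : ∀ s t : unitInterval, s ≤ t → f (m s) = f (m t) ∨
      ∃ u ∈ Icc (0:ℝ) 1, ∃ v ∈ Icc (0:ℝ) 1, dist u v ≤ dist s t ∧ f (m s) = f u ∧ f (m t) = f v := by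
    intro s t hst
    have hst' : (s : ℝ) ≤ t := hst
    rcases lt_or_ge (m t) s with h | h
    · left
      have : m t ≤ m s := (hm s).2 ⟨(hm t).1.1, (hm t).1.2.1, h.le⟩
      rw [le_antisymm this (hmono s t hst)]
    · right
      have hMs : M s ≤ m t := (hM s).2 ⟨(hm t).1.1, h, (hm t).1.2.2.trans t.2.2⟩
      refine ⟨M s, hsub (hM s).1.1, m t, hsub (hm t).1.1, ?_, hmM s, rfl⟩
      have h1 := (hM s).1.2.1
      have h2 := (hm t).1.2.2
      rw [Subtype.dist_eq, Real.dist_eq, Real.dist_eq, abs_sub_comm, abs_of_nonneg (by linarith),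
        abs_sub_comm, abs_of_nonneg (by linarith)]
      linarith
  have huc := isCompact_Icc.uniformContinuousOn_of_continuous (hf.continuousOn (s := Icc (0:ℝ) 1))
  rw [Metric.uniformContinuousOn_iff] at huc
  refine ⟨fun t => f (m t), ?_, ?_, ?_, ?_, ?_⟩
  · refine UniformContinuous.continuous (Metric.uniformContinuous_iff.2 fun ε hε => ?_)
    obtain ⟨δ, hδ, H⟩ := huc ε hε
    refine ⟨δ, hδ, ?_⟩
    have H' : ∀ s t : unitInterval, s ≤ t → dist s t < δ → dist (f (m s)) (f (m t)) < ε := by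
      intro s t hst hd
      rcases key s t hst with h | ⟨u, hu, v, hv, huv, e1, e2⟩
      · rw [h, dist_self]; exact hε
      · rw [e1, e2]; exact H u hu v hv (by linarith)
    intro s t hd
    rcases le_total s t with h | h
    · exact H' s t h hd
    · rw [dist_comm]; exact H' t s h (by rwa [dist_comm])
  · have h := (hm 0).1.2
    have : m 0 = 0 := le_antisymm h.2 h.1
    simp [this]
  · have : m 1 = 1 := le_antisymm (hm 1).1.2.2 ((hm 1).2 ⟨h1, by simp, le_rfl⟩)
    simp [this]
  · rintro _ ⟨t, rfl⟩
    exact ⟨m t, hsub (hm t).1.1, rfl⟩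
  · intro s t hst heq r hsr hrt
    dsimp only at heq ⊢
    rcases (hmono s t hst).lt_or_eq with h | h
    · have h3 := hmin _ (hm s).1.1 _ (hm t).1.1 h heq _ (hm r).1.1
      rcases (hmono s r hsr).lt_or_eq with h4 | h4
      · rcases (hmono r t hrt).lt_or_eq with h5 | h5
        · exact absurd ⟨h4, h5⟩ h3
        · rw [h5, heq]
      · rw [h4]
    · have : m r = m s := le_antisymm ((hmono r t hrt).trans h.ge) (hmono s r hsr)
      rw [this]

lemma exists_reparam {X : Type*} [MetricSpace X] [TopologicalSpace.SeparableSpace X]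
    (g : unitInterval → X) (hg : Continuous g) (h01 : g 0 ≠ g 1)
    (hmon : ∀ s t, s ≤ t → g s = g t → ∀ r, s ≤ r → r ≤ t → g r = g s) :
    ∃ α : unitInterval → X, Continuous α ∧ Function.Injective α ∧ α 0 = g 0 ∧ α 1 = g 1 ∧
      range α ⊆ range g := by
  have : Nonempty X := ⟨g 0⟩
  let x : ℕ → X := TopologicalSpace.denseSeq X
  let F : ℕ → unitInterval → unitInterval → ℝ := fun k t r => min 1 (dist (g (min r t)) (x k))
  have hF0 : ∀ k t r, 0 ≤ F k t r := fun k t r => le_min zero_le_one dist_nonneg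
  have hF1 : ∀ k t r, F k t r ≤ 1 := fun k t r => min_le_left _ _
  let h : ℕ → unitInterval → ℝ := fun k t => sInf (F k t '' univ)
  have hbdd : ∀ k t, BddBelow (F k t '' univ) := fun k t =>
    ⟨0, by rintro _ ⟨r, -, rfl⟩; exact hF0 k t r⟩
  have hcont : ∀ k, Continuous (h k) := by
    intro k
    refine isCompact_univ.continuous_sInf ?_
    change Continuous fun p : unitInterval × unitInterval => min 1 (dist (g (min p.2 p.1)) (x k))
    fun_prop
  have hle : ∀ k t r, h k t ≤ F k t r := fun k t r => csInf_le (hbdd k t) ⟨r, mem_univ _, rfl⟩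
  have hge : ∀ k t c, (∀ r, c ≤ F k t r) → c ≤ h k t := fun k t c hc =>
    le_csInf ⟨_, 0, mem_univ _, rfl⟩ (by rintro _ ⟨r, -, rfl⟩; exact hc r)
  have h0 : ∀ k t, 0 ≤ h k t := fun k t => hge k t 0 (hF0 k t)
  have h1 : ∀ k t, h k t ≤ 1 := fun k t => (hle k t 0).trans (hF1 _ _ _)
  have hanti : ∀ k s t, s ≤ t → h k t ≤ h k s := by
    intro k s t hst
    refine hge k s _ fun r => (hle k t (min r s)).trans (le_of_eq ?_)
    simp only [F, min_assoc, min_eq_left hst]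
  let φ : unitInterval → ℝ := fun t => ∑' k, (1 / 2 : ℝ) ^ k * h k t
  have hsummable : ∀ t, Summable fun k => (1 / 2 : ℝ) ^ k * h k t := fun t =>
    Summable.of_nonneg_of_le (fun k => mul_nonneg (by positivity) (h0 k t))
      (fun k => mul_le_of_le_one_right (by positivity) (h1 k t)) summable_geometric_two
  have hφc : Continuous φ := by
    refine continuous_tsum (u := fun k => (1 / 2 : ℝ) ^ k) (fun k => (hcont k).const_mul _)
      summable_geometric_two ?_
    intro k t
    rw [Real.norm_of_nonneg (mul_nonneg (by positivity) (h0 k t))]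
    exact mul_le_of_le_one_right (by positivity) (h1 k t)
  have hφanti : ∀ s t, s ≤ t → φ t ≤ φ s := fun s t hst =>
    (hsummable t).tsum_le_tsum
      (fun k => mul_le_mul_of_nonneg_left (hanti k s t hst) (by positivity)) (hsummable s)
  have hφlt : ∀ s t, s ≤ t → g s ≠ g t → φ t < φ s := by
    intro s t hst hne
    have hcl : IsClosed (range fun r => g (min r s)) := by
      refine (isCompact_range ?_).isClosed
      fun_prop
    have hnot : g t ∉ range fun r => g (min r s) := by
      rintro ⟨r, hr⟩
      dsimp only at hr
      have hle : min r s ≤ t := (min_le_right _ _).trans hst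
      have := hmon _ _ hle hr s (min_le_right _ _) hst
      exact hne (this.trans hr)
    obtain ⟨δ, hδ, hball⟩ := Metric.isOpen_iff.1 hcl.isOpen_compl _ hnot
    have hfar : ∀ r, δ ≤ dist (g (min r s)) (g t) := by
      intro r
      by_contra hlt
      exact hball (Metric.mem_ball.2 (not_le.1 hlt)) ⟨r, rfl⟩
    have hpos : 0 < min 1 (δ / 2) := lt_min one_pos (half_pos hδ)
    obtain ⟨k, hk⟩ := (TopologicalSpace.denseRange_denseSeq X).exists_dist_lt (g t) hpos
    change dist (g t) (x k) < _ at hk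
    refine Summable.tsum_lt_tsum (i := k)
      (fun k => mul_le_mul_of_nonneg_left (hanti k s t hst) (by positivity)) ?_
      (hsummable t) (hsummable s)
    refine mul_lt_mul_of_pos_left ?_ (by positivity)
    calc h k t ≤ F k t t := hle k t t
      _ ≤ dist (g t) (x k) := by simp [F]
      _ < min 1 (δ / 2) := hk
      _ ≤ h k s := by
        refine hge k s _ fun r => ?_
        refine min_le_min le_rfl ?_
        have e1 := hfar r
        have e2 := dist_triangle_right (g (min r s)) (g t) (x k)
        have e3 := hk.trans_le (min_le_right _ _)
        linarith
  have hpos : 0 < φ 0 - φ 1 := sub_pos.2 (hφlt 0 1 unitInterval.le_one' h01)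
  have hmem : ∀ t, (φ 0 - φ t) / (φ 0 - φ 1) ∈ Icc (0 : ℝ) 1 := by
    intro t
    have e1 := hφanti 0 t unitInterval.nonneg'
    have e2 := hφanti t 1 unitInterval.le_one'
    constructor
    · exact div_nonneg (by linarith) hpos.le
    · rw [div_le_one hpos]; linarith
  let ψ : unitInterval → unitInterval := fun t => ⟨_, hmem t⟩
  have hψc : Continuous ψ := by
    refine Continuous.subtype_mk ?_ _
    fun_prop
  have hψ0 : ψ 0 = 0 := by ext; simp [ψ]
  have hψ1 : ψ 1 = 1 := by ext; simp [ψ, div_self hpos.ne']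
  have hψs : Function.Surjective ψ := by
    intro y
    have := intermediate_value_univ (0 : unitInterval) 1 hψc
    rw [hψ0, hψ1] at this
    exact this ⟨unitInterval.nonneg', unitInterval.le_one'⟩
  have hψφ : ∀ s t, ψ s = ψ t → φ s = φ t := by
    intro s t hst
    have := congrArg Subtype.val hst
    simp only [ψ] at this
    rw [div_left_inj' hpos.ne'] at this
    linarith
  have hψg : ∀ s t, ψ s = ψ t → g s = g t := by
    intro s t hst
    by_contra hne
    rcases le_total s t with hle | hle
    · exact absurd (hψφ s t hst) (hφlt s t hle hne).ne'
    · exact absurd (hψφ s t hst) (hφlt t s hle (Ne.symm hne)).ne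
  have hgψ : ∀ s t, s ≤ t → g s = g t → ψ s = ψ t := by
    intro s t hst heq
    have : ∀ k, h k s = h k t := by
      intro k
      refine le_antisymm ?_ (hanti k s t hst)
      refine hge k t _ fun r => ?_
      rcases le_total r s with hrs | hrs
      · refine (hle k s r).trans (le_of_eq ?_)
        simp only [F, min_eq_left hrs, min_eq_left (hrs.trans hst)]
      · refine (hle k s s).trans (le_of_eq ?_)
        simp only [F, min_self]
        rw [hmon s t hst heq (min r t) (le_min hrs hst) (min_le_right _ _)]
    have hφ : φ s = φ t := by simp only [φ, this]
    ext
    simp only [ψ, hφ]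
  let α : unitInterval → X := fun y => g (Function.surjInv hψs y)
  have hα : ∀ t, α (ψ t) = g t := fun t => hψg _ _ (Function.surjInv_eq hψs _)
  refine ⟨α, ?_, ?_, ?_, ?_, ?_⟩
  · rw [(hψc.isClosedMap.isQuotientMap hψc hψs).continuous_iff]
    exact hg.congr fun t => (hα t).symm
  · intro y y' hyy
    obtain ⟨s, rfl⟩ := hψs y
    obtain ⟨t, rfl⟩ := hψs y'
    rw [hα, hα] at hyy
    rcases le_total s t with hle | hle
    · exact hgψ s t hle hyy
    · exact (hgψ t s hle hyy.symm).symm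
  · exact (congrArg α hψ0.symm).trans (hα 0)
  · exact (congrArg α hψ1.symm).trans (hα 1)
  · rintro _ ⟨y, rfl⟩
    exact ⟨_, rfl⟩

/-- Every path between distinct points contains an arc. -/
lemma exists_arc {X : Type*} [MetricSpace X] [TopologicalSpace.SeparableSpace X] {p q : X}
    (γ : Path p q) (hpq : p ≠ q) :
    ∃ α : Path p q, Function.Injective α ∧ range α ⊆ range γ := by
  obtain ⟨g, hgc, hg0, hg1, hgr, hgm⟩ := exists_monotone_path γ.extend γ.extend.continuous
  rw [Path.extend_zero] at hg0
  rw [Path.extend_one] at hg1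
  obtain ⟨α, hαc, hαi, hα0, hα1, hαr⟩ := exists_reparam g hgc (by rw [hg0, hg1]; exact hpq) hgm
  refine ⟨⟨⟨α, hαc⟩, hα0.trans hg0, hα1.trans hg1⟩, hαi, ?_⟩
  refine hαr.trans (hgr.trans ?_)
  rw [← Path.extend_range]
  exact image_subset_range _ _

/-- Two arcs with common endpoints that are otherwise disjoint form a circle. -/
lemma exists_circle {X : Type*} [MetricSpace X] {p q : X} (α β : Path p q)
    (hα : Function.Injective α) (hβ : Function.Injective β)
    (hd : ∀ s t, α s = β t → s = 0 ∨ s = 1) :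
    ∃ S : Set X, S ⊆ range α ∪ range β ∧ Nonempty (S ≃ₜ Circle) := by
  have : Fact ((0 : ℝ) < 1) := ⟨one_pos⟩
  let ℓ := α.trans β.symm
  let c : AddCircle (1 : ℝ) → X := AddCircle.liftIco 1 0 ℓ.extend
  have hc : Continuous c :=
    AddCircle.liftIco_zero_continuous (by simp) ℓ.extend.continuous.continuousOn
  have hinj2 : ∀ x ∈ Ico (0 : ℝ) 1, ∀ y ∈ Ico (0 : ℝ) 1, x < y → ℓ.extend x ≠ ℓ.extend y := by
    rintro x ⟨hx0, hx1⟩ y ⟨hy0, hy1⟩ hxy heq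
    rcases le_or_gt y (1 / 2) with hy | hy
    · rw [Path.extend_trans_of_le_half _ _ (by linarith), Path.extend_trans_of_le_half _ _ hy,
        Path.extend_apply _ ⟨by linarith, by linarith⟩,
        Path.extend_apply _ ⟨by linarith, by linarith⟩] at heq
      have := congrArg Subtype.val (hα heq)
      dsimp only at this
      linarith
    · rw [Path.extend_trans_of_half_le _ _ hy.le, Path.extend_symm_apply] at heq
      rcases le_or_gt x (1 / 2) with hx | hx
      · rw [Path.extend_trans_of_le_half _ _ hx,
          Path.extend_apply _ ⟨by linarith, by linarith⟩,
          Path.extend_apply _ ⟨by linarith, by linarith⟩] at heq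
        rcases hd _ _ heq with h | h
        · rw [h, α.source] at heq
          have h2 := congrArg Subtype.val h
          have := congrArg Subtype.val (hβ (β.source.trans heq))
          simp at this h2
          linarith
        · rw [h, α.target] at heq
          have h2 := congrArg Subtype.val h
          have := congrArg Subtype.val (hβ (β.target.trans heq))
          simp at this h2
          linarith
      · rw [Path.extend_trans_of_half_le _ _ hx.le, Path.extend_symm_apply,
          Path.extend_apply _ ⟨by linarith, by linarith⟩,
          Path.extend_apply _ ⟨by linarith, by linarith⟩] at heq
        have := congrArg Subtype.val (hβ heq)
        dsimp only at this
        linarith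
  have hci : Function.Injective c := by
    intro a b hab
    obtain ⟨x, hx, rfl⟩ := AddCircle.eq_coe_Ico a
    obtain ⟨y, hy, rfl⟩ := AddCircle.eq_coe_Ico b
    simp only [c] at hab
    rw [AddCircle.liftIco_zero_coe_apply hx, AddCircle.liftIco_zero_coe_apply hy] at hab
    rcases lt_trichotomy x y with h | h | h
    · exact absurd hab (hinj2 x hx y hy h)
    · rw [h]
    · exact absurd hab.symm (hinj2 y hy x hx h)
  refine ⟨range c, ?_, ⟨(hc.isClosedEmbedding hci).isEmbedding.toHomeomorph.symm.trans
    (AddCircle.homeomorphCircle one_ne_zero)⟩⟩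
  rintro _ ⟨a, rfl⟩
  obtain ⟨x, hx, rfl⟩ := AddCircle.eq_coe_Ico a
  simp only [c]
  rw [AddCircle.liftIco_zero_coe_apply hx, ← β.symm_range, ← Path.trans_range, ← Path.extend_range]
  exact ⟨x, rfl⟩

/-- Restriction of an injective path to a subinterval, as an injective path. -/
lemma exists_subarc {X : Type*} [MetricSpace X] {p q : X} (α : Path p q)
    (hα : Function.Injective α) (s t : unitInterval) (hst : s ≠ t) :
    ∃ α' : Path (α s) (α t), Function.Injective α' ∧ range α' ⊆ range α ∧
      (s ≤ t → ∀ x, ∃ r, s ≤ r ∧ r ≤ t ∧ α' x = α r ∧ (r = s → x = 0) ∧ (r = t → x = 1)) := by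
  have hmem : ∀ x : unitInterval, (1 - (x : ℝ)) * s + x * t ∈ Icc (0 : ℝ) 1 := by
    intro x
    have h1 := x.2.1
    have h2 := x.2.2
    have := s.2.1
    have := s.2.2
    have := t.2.1
    have := t.2.2
    constructor
    · have := mul_nonneg (sub_nonneg.2 h2) s.2.1
      have := mul_nonneg h1 t.2.1
      linarith
    · nlinarith
  let u : unitInterval → unitInterval := fun x => ⟨_, hmem x⟩
  have hu : Continuous u := by
    refine Continuous.subtype_mk ?_ _
    fun_prop
  have hne : (s : ℝ) - t ≠ 0 := sub_ne_zero.2 fun h => hst (Subtype.ext h)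
  have hu0 : u 0 = s := by ext; simp [u]
  have hu1 : u 1 = t := by ext; simp [u]
  have hui : Function.Injective u := by
    intro x y hxy
    have := congrArg Subtype.val hxy
    simp only [u] at this
    have h2 : ((x : ℝ) - y) * (s - t) = 0 := by linarith
    ext
    rcases mul_eq_zero.1 h2 with h | h
    · linarith
    · exact absurd h hne
  refine ⟨⟨⟨α ∘ u, α.continuous.comp hu⟩, by simp [hu0], by simp [hu1]⟩, hα.comp hui, ?_, ?_⟩
  · rintro _ ⟨x, rfl⟩
    exact ⟨u x, rfl⟩
  · intro hle x
    have hle' : (s : ℝ) ≤ t := hle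
    refine ⟨u x, ?_, ?_, rfl, ?_, ?_⟩
    · change (s : ℝ) ≤ (1 - (x : ℝ)) * s + x * t
      nlinarith [x.2.1, x.2.2]
    · change (1 - (x : ℝ)) * s + x * t ≤ (t : ℝ)
      nlinarith [x.2.1, x.2.2]
    · intro h; exact hui (h.trans hu0.symm)
    · intro h; exact hui (h.trans hu1.symm)

/-- If no circle lies in `K`, arcs with the same endpoints are contained in each other. -/
lemma arc_subset_arc {X : Type*} [MetricSpace X] {K : Set X}
    (hK : ¬ ∃ S : Set X, S ⊆ K ∧ Nonempty (S ≃ₜ Circle)) {p q : X} (α β : Path p q)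
    (hα : Function.Injective α) (hβ : Function.Injective β)
    (hαK : range α ⊆ K) (hβK : range β ⊆ K) : range α ⊆ range β := by
  rintro _ ⟨t₀, rfl⟩
  by_contra ht₀
  have hcl : IsClosed (α ⁻¹' range β) :=
    (isCompact_range β.continuous).isClosed.preimage α.continuous
  have h0 : (0 : unitInterval) ∈ α ⁻¹' range β := by simp
  have h1 : (1 : unitInterval) ∈ α ⁻¹' range β := by simp
  obtain ⟨s, ⟨hsC, -, hs⟩, hsmax⟩ :=
    (isCompact_Icc.inter_left hcl : IsCompact (α ⁻¹' range β ∩ Icc 0 t₀)).exists_isGreatest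
      ⟨0, h0, le_rfl, unitInterval.nonneg'⟩
  obtain ⟨t, ⟨htC, ht, -⟩, htmin⟩ :=
    (isCompact_Icc.inter_left hcl : IsCompact (α ⁻¹' range β ∩ Icc t₀ 1)).exists_isLeast
      ⟨1, h1, unitInterval.le_one', le_rfl⟩
  have hs' : s < t₀ := lt_of_le_of_ne hs (by rintro rfl; exact ht₀ hsC)
  have ht' : t₀ < t := lt_of_le_of_ne ht (by rintro rfl; exact ht₀ htC)
  have hst : s < t := hs'.trans ht'
  obtain ⟨u, hu⟩ := hsC
  obtain ⟨v, hv⟩ := htC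
  have huv : u ≠ v := by
    rintro rfl
    exact hst.ne (hα (hu.symm.trans hv))
  obtain ⟨α', hα'i, hα'r, hα'⟩ := exists_subarc α hα s t hst.ne
  obtain ⟨β', hβ'i, hβ'r, -⟩ := exists_subarc β hβ u v huv
  obtain ⟨S, hS, hSc⟩ := exists_circle α' (β'.cast hu.symm hv.symm) hα'i hβ'i (by
    intro x y hxy
    obtain ⟨r, hsr, hrt, hr, hr0, hr1⟩ := hα' hst.le x
    have hrC : α r ∈ range β := by
      rw [← hr, hxy]
      exact hβ'r ⟨y, rfl⟩
    rcases le_total r t₀ with h | h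
    · exact Or.inl (hr0 (le_antisymm (hsmax ⟨hrC, unitInterval.nonneg', h⟩) hsr))
    · exact Or.inr (hr1 (le_antisymm hrt (htmin ⟨hrC, h, unitInterval.le_one'⟩))))
  refine hK ⟨S, hS.trans (union_subset (hα'r.trans hαK) ?_), hSc⟩
  exact hβ'r.trans hβK

lemma arc_subset_path {X : Type*} [MetricSpace X] [TopologicalSpace.SeparableSpace X] {K : Set X}
    (hK : ¬ ∃ S : Set X, S ⊆ K ∧ Nonempty (S ≃ₜ Circle)) {p q : X} (hpq : p ≠ q) (α γ : Path p q)
    (hα : Function.Injective α) (hαK : range α ⊆ K) (hγK : range γ ⊆ K) :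
    range α ⊆ range γ := by
  obtain ⟨β, hβ, hβr⟩ := exists_arc γ hpq
  exact (arc_subset_arc hK α β hα hβ hαK (hβr.trans hγK)).trans hβr

section Fractal

variable {n : ℕ} {D : Set (ℤ × ℤ)} {K : Set (ℝ × ℝ)}

lemma pieceMap_continuous (n : ℕ) (d : ℤ × ℤ) : Continuous (pieceMap n d) := by
  unfold pieceMap
  fun_prop

lemma pieceMap_fst (n : ℕ) (d : ℤ × ℤ) (x : ℝ × ℝ) :
    (pieceMap n d x).1 = (x.1 + d.1) / n := by
  simp [pieceMap, coeZ2, div_eq_inv_mul, mul_add]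

lemma pieceMap_snd (n : ℕ) (d : ℤ × ℤ) (x : ℝ × ℝ) :
    (pieceMap n d x).2 = (x.2 + d.2) / n := by
  simp [pieceMap, coeZ2, div_eq_inv_mul, mul_add]

lemma pieceMap_dist (n : ℕ) (d : ℤ × ℤ) (x y : ℝ × ℝ) :
    dist (pieceMap n d x) (pieceMap n d y) = (n : ℝ)⁻¹ * dist x y := by
  unfold pieceMap
  rw [dist_smul₀, dist_add_right]
  simp

lemma IsFractalSquare.piece_mem (hK : IsFractalSquare n D K) {d : ℤ × ℤ} (hd : d ∈ D)
    {x : ℝ × ℝ} (hx : x ∈ K) : pieceMap n d x ∈ K := by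
  rw [hK.2.2.2.2.2.2]
  exact mem_biUnion hd ⟨x, hx, rfl⟩

lemma IsFractalSquare.exists_piece (hK : IsFractalSquare n D K)
    {x : ℝ × ℝ} (hx : x ∈ K) : ∃ d ∈ D, ∃ y ∈ K, pieceMap n d y = x := by
  have hx' := hx
  rw [hK.2.2.2.2.2.2] at hx'
  obtain ⟨d, hd, y, hy, h⟩ := mem_iUnion₂.1 hx'
  exact ⟨d, hd, y, hy, h⟩

lemma IsFractalSquare.two_le (hK : IsFractalSquare n D K) : (2 : ℝ) ≤ n := by
  exact_mod_cast hK.1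

lemma IsFractalSquare.digit (hK : IsFractalSquare n D K) {d : ℤ × ℤ} (hd : d ∈ D) :
    (0 : ℝ) ≤ d.1 ∧ (0 : ℝ) ≤ d.2 ∧ (d.1 : ℝ) ≤ n - 1 ∧ (d.2 : ℝ) ≤ n - 1 := by
  obtain ⟨⟨h1, h2⟩, h3, h4⟩ := hK.2.1 hd
  dsimp only at h1 h2 h3 h4
  refine ⟨by exact_mod_cast h1, by exact_mod_cast h2, ?_, ?_⟩
  · exact_mod_cast h3
  · exact_mod_cast h4

lemma IsFractalSquare.le_of_step (hK : IsFractalSquare n D K) (π : ℝ × ℝ → ℝ) (hπ : Continuous π)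
    (c : ℝ) (h : ∀ d ∈ D, ∀ y, π (pieceMap n d y) ≤ (π y + (n - 1) * c) / n) :
    ∀ x ∈ K, π x ≤ c := by
  obtain ⟨x₀, hx₀, hmax⟩ := hK.2.2.2.2.2.1.exists_isMaxOn hK.2.2.2.2.1 hπ.continuousOn
  have hn := hK.two_le
  obtain ⟨d, hd, y, hy, hyx⟩ := hK.exists_piece hx₀
  have h1 := h d hd y
  have h2 : π y ≤ π x₀ := hmax hy
  rw [hyx, le_div_iff₀ (by linarith)] at h1
  have h3 : π x₀ ≤ c := by nlinarith
  intro x hx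
  exact (hmax hx : π x ≤ π x₀).trans h3

lemma IsFractalSquare.bounds (hK : IsFractalSquare n D K) {x : ℝ × ℝ} (hx : x ∈ K) :
    0 ≤ x.1 ∧ 0 ≤ x.2 ∧ x.1 ≤ 1 ∧ x.2 ≤ 1 := by
  have hn := hK.two_le
  have hn0 : (0 : ℝ) < n := by linarith
  have e1 := hK.le_of_step (fun x => - x.1) (by fun_prop) 0 (by
    intro d hd y
    have := hK.digit hd
    rw [pieceMap_fst, ← neg_div]
    gcongr
    linarith) x hx
  have e2 := hK.le_of_step (fun x => - x.2) (by fun_prop) 0 (by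
    intro d hd y
    have := hK.digit hd
    rw [pieceMap_snd, ← neg_div]
    gcongr
    linarith) x hx
  have e3 := hK.le_of_step (fun x => x.1) (by fun_prop) 1 (by
    intro d hd y
    have := hK.digit hd
    rw [pieceMap_fst]
    gcongr
    linarith) x hx
  have e4 := hK.le_of_step (fun x => x.2) (by fun_prop) 1 (by
    intro d hd y
    have := hK.digit hd
    rw [pieceMap_snd]
    gcongr
    linarith) x hx
  exact ⟨by linarith, by linarith, e3, e4⟩

lemma IsFractalSquare.fixed_mem (hK : IsFractalSquare n D K) {d : ℤ × ℤ} (hd : d ∈ D)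
    {c : ℝ × ℝ} (hc : pieceMap n d c = c) : c ∈ K := by
  obtain ⟨x, hx⟩ := hK.2.2.2.2.1
  have hn := hK.two_le
  have hmem : ∀ k, (pieceMap n d)^[k] x ∈ K := by
    intro k
    induction k with
    | zero => exact hx
    | succ k ih => rw [Function.iterate_succ_apply']; exact hK.piece_mem hd ih
  have hdist : ∀ k, dist ((pieceMap n d)^[k] x) c = (n : ℝ)⁻¹ ^ k * dist x c := by
    intro k
    induction k with
    | zero => simp
    | succ k ih =>
      rw [Function.iterate_succ_apply']
      nth_rewrite 1 [← hc]
      rw [pieceMap_dist, ih, pow_succ]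
      ring
  refine hK.2.2.2.2.2.1.isClosed.mem_of_tendsto (f := fun k => (pieceMap n d)^[k] x) 
    (b := Filter.atTop) ?_ (Filter.Eventually.of_forall hmem)
  rw [tendsto_iff_dist_tendsto_zero]
  simp only [hdist]
  have : Filter.Tendsto (fun k : ℕ => (n : ℝ)⁻¹ ^ k) Filter.atTop (nhds 0) :=
    tendsto_pow_atTop_nhds_zero_of_lt_one (by positivity) (inv_lt_one_of_one_lt₀ (by linarith))
  simpa using this.mul_const (dist x c)

/-- `p` and `q` can be joined by a concatenation of small copies of paths in a given family. -/
def Refines (n : ℕ) (D : Set (ℤ × ℤ)) (K : Set (ℝ × ℝ)) (p q : K) : Prop :=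
  ∃ T : (∀ p q : K, Path (p : ℝ × ℝ) q) → Path (p : ℝ × ℝ) q,
    ∀ t, ∃ d ∈ D, ∃ p' q' : K, ∃ s, ∀ Γ, T Γ t = pieceMap n d (Γ p' q' s)

lemma refines_piece {d : ℤ × ℤ} (hd : d ∈ D) (a b p q : K) (hp : pieceMap n d a = p)
    (hq : pieceMap n d b = q) : Refines n D K p q :=
  ⟨fun Γ => ((Γ a b).map (pieceMap_continuous n d)).cast hp.symm hq.symm,
    fun t => ⟨d, hd, a, b, t, fun Γ => rfl⟩⟩

lemma Refines.trans {p q r : K} (h₁ : Refines n D K p q) (h₂ : Refines n D K q r) :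
    Refines n D K p r := by
  obtain ⟨T₁, h₁⟩ := h₁
  obtain ⟨T₂, h₂⟩ := h₂
  refine ⟨fun Γ => (T₁ Γ).trans (T₂ Γ), fun t => ?_⟩
  by_cases ht : (t : ℝ) ≤ 1 / 2
  · obtain ⟨d, hd, p', q', s, h⟩ :=
      h₁ ⟨2 * t, (unitInterval.mul_pos_mem_iff zero_lt_two).2 ⟨t.2.1, ht⟩⟩
    refine ⟨d, hd, p', q', s, fun Γ => ?_⟩
    rw [Path.trans_apply, dif_pos ht, h]
  · obtain ⟨d, hd, p', q', s, h⟩ :=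
      h₂ ⟨2 * t - 1, unitInterval.two_mul_sub_one_mem_iff.2 ⟨(not_le.1 ht).le, t.2.2⟩⟩
    refine ⟨d, hd, p', q', s, fun Γ => ?_⟩
    rw [Path.trans_apply, dif_neg ht, h]

lemma IsFractalSquare.refines (hK : IsFractalSquare n D K) (hc : IsPreconnected K) (p q : K) :
    Refines n D K p q := by
  have hfin : D.Finite := (Set.finite_Icc _ _).subset hK.2.1
  have hcl : ∀ d, IsClosed (pieceMap n d '' K) := fun d =>
    (hK.2.2.2.2.2.1.image (pieceMap_continuous n d)).isClosed
  let D₁ : Set (ℤ × ℤ) := {d ∈ D | ∀ a : K, ∀ z : K, pieceMap n d a = z → Refines n D K p z}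
  let D₂ : Set (ℤ × ℤ) := {d ∈ D | ∀ a : K, ∀ z : K, pieceMap n d a = z → ¬ Refines n D K p z}
  have hdich : ∀ d ∈ D, d ∈ D₁ ∨ d ∈ D₂ := by
    intro d hd
    by_cases h : d ∈ D₂
    · exact Or.inr h
    · left
      have : ∃ a z : K, pieceMap n d a = z ∧ Refines n D K p z := by
        by_contra hne
        push Not at hne
        exact h ⟨hd, hne⟩
      obtain ⟨a, z, haz, hz⟩ := this
      exact ⟨hd, fun b w hbw => hz.trans (refines_piece hd a b z w haz hbw)⟩
  have hC : ∀ D' ⊆ D, IsClosed (⋃ d ∈ D', pieceMap n d '' K) := fun D' hD' =>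
    (hfin.subset hD').isClosed_biUnion fun d _ => hcl d
  by_contra hpq
  have hall : ∀ z : K, (z : ℝ × ℝ) ∈ (⋃ d ∈ D₁, pieceMap n d '' K) ∪
      (⋃ d ∈ D₂, pieceMap n d '' K) := by
    intro z
    obtain ⟨d, hd, y, hy, hyz⟩ := hK.exists_piece z.2
    rcases hdich d hd with h | h
    · exact Or.inl (mem_biUnion h ⟨y, hy, hyz⟩)
    · exact Or.inr (mem_biUnion h ⟨y, hy, hyz⟩)
  have h1 : ∀ z : K, (z : ℝ × ℝ) ∈ (⋃ d ∈ D₁, pieceMap n d '' K) → Refines n D K p z := by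
    intro z hz
    obtain ⟨d, hd, y, hy, h⟩ := mem_iUnion₂.1 hz
    exact hd.2 ⟨y, hy⟩ z h
  have h2 : ∀ z : K, (z : ℝ × ℝ) ∈ (⋃ d ∈ D₂, pieceMap n d '' K) → ¬ Refines n D K p z := by
    intro z hz
    obtain ⟨d, hd, y, hy, h⟩ := mem_iUnion₂.1 hz
    exact hd.2 ⟨y, hy⟩ z h
  have hpp : Refines n D K p p := by
    obtain ⟨d, hd, y, hy, hyz⟩ := hK.exists_piece p.2
    exact refines_piece hd ⟨y, hy⟩ ⟨y, hy⟩ p p hyz hyz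
  obtain ⟨z, hz, hz1, hz2⟩ := isPreconnected_closed_iff.1 hc _ _ (hC D₁ (sep_subset _ _))
    (hC D₂ (sep_subset _ _)) (fun z hz => hall ⟨z, hz⟩)
    ⟨p, p.2, (hall p).resolve_right fun h => h2 p h hpp⟩
    ⟨q, q.2, (hall q).resolve_left fun h => hpq (h1 q h)⟩
  exact h2 ⟨z, hz⟩ hz2 (h1 ⟨z, hz⟩ hz1)

/-- A connected fractal square is path connected. -/
lemma IsFractalSquare.exists_path (hK : IsFractalSquare n D K) (hc : IsPreconnected K)
    {p q : ℝ × ℝ} (hp : p ∈ K) (hq : q ∈ K) : ∃ γ : Path p q, range γ ⊆ K := by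
  have hn := hK.two_le
  have hr0 : (0 : ℝ) ≤ (n : ℝ)⁻¹ := by positivity
  have hr1 : (n : ℝ)⁻¹ < 1 := inv_lt_one_of_one_lt₀ (by linarith)
  have hnorm : ∀ z ∈ K, ‖z‖ ≤ 1 := by
    intro z hz
    obtain ⟨h1, h2, h3, h4⟩ := hK.bounds hz
    rw [Prod.norm_def, max_le_iff, Real.norm_of_nonneg h1, Real.norm_of_nonneg h2]
    exact ⟨h3, h4⟩
  choose T hT using fun p q : K => hK.refines hc p q
  let Γ : ℕ → ∀ p q : K, Path (p : ℝ × ℝ) q := fun k =>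
    Nat.rec (fun p q => Path.segment (p : ℝ × ℝ) q) (fun _ G p q => T p q G) k
  have hΓs : ∀ k p q, Γ (k + 1) p q = T p q (Γ k) := fun k p q => rfl
  have hnear : ∀ k p q s, ∃ z ∈ K, dist (Γ k p q s) z ≤ 2 * (n : ℝ)⁻¹ ^ k := by
    intro k
    induction k with
    | zero =>
      intro p q s
      refine ⟨p, p.2, ?_⟩
      have : Γ 0 p q s ∈ segment ℝ (p : ℝ × ℝ) q := by
        rw [← Path.range_segment]
        exact ⟨s, rfl⟩
      have h1 := (convex_closedBall (0 : ℝ × ℝ) 1).segment_subset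
        (mem_closedBall_zero_iff.2 (hnorm p p.2)) (mem_closedBall_zero_iff.2 (hnorm q q.2)) this
      have h2 := dist_le_norm_add_norm (Γ 0 p q s) p
      have h3 := hnorm p p.2
      rw [mem_closedBall_zero_iff] at h1
      rw [pow_zero]
      linarith
    | succ k ih =>
      intro p q s
      obtain ⟨d, hd, p', q', s', h⟩ := hT p q s
      obtain ⟨z, hz, hzd⟩ := ih p' q' s'
      refine ⟨pieceMap n d z, hK.piece_mem hd hz, ?_⟩
      rw [hΓs, h, pieceMap_dist, pow_succ]
      have := mul_le_mul_of_nonneg_left hzd hr0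
      linarith
  have hstep : ∀ k p q s, dist (Γ k p q s) (Γ (k + 1) p q s) ≤ 6 * (n : ℝ)⁻¹ ^ k := by
    intro k
    induction k with
    | zero =>
      intro p q s
      obtain ⟨z, hz, h1⟩ := hnear 0 p q s
      obtain ⟨w, hw, h2⟩ := hnear (0 + 1) p q s
      have h3 := dist_triangle4 (Γ 0 p q s) z w (Γ (0 + 1) p q s)
      have h4 := dist_le_norm_add_norm z w
      have h5 := hnorm z hz
      have h6 := hnorm w hw
      rw [dist_comm] at h2
      rw [pow_zero] at *
      rw [zero_add, pow_one] at h2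
      rw [zero_add] at *
      linarith
    | succ k ih =>
      intro p q s
      obtain ⟨d, hd, p', q', s', h⟩ := hT p q s
      rw [hΓs (k + 1), hΓs k, h, h, pieceMap_dist, pow_succ]
      have := mul_le_mul_of_nonneg_left (ih p' q' s') hr0
      linarith
  let P : K := ⟨p, hp⟩
  let Q : K := ⟨q, hq⟩
  let u : ℕ → C(unitInterval, ℝ × ℝ) := fun k => (Γ k P Q).toContinuousMap
  have hu : CauchySeq u := by
    refine cauchySeq_of_le_geometric (n : ℝ)⁻¹ 6 hr1 fun k => ?_
    rw [ContinuousMap.dist_le (by positivity)]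
    exact fun s => hstep k P Q s
  obtain ⟨f, hf⟩ := cauchySeq_tendsto_of_complete hu
  have hfs : ∀ s, Filter.Tendsto (fun k => Γ k P Q s) Filter.atTop (nhds (f s)) := fun s =>
    ((continuous_eval_const (F := C(unitInterval, ℝ × ℝ)) s).tendsto f).comp hf
  refine ⟨⟨f, ?_, ?_⟩, ?_⟩
  · refine tendsto_nhds_unique (hfs 0) ?_
    simp only [Path.source]
    exact tendsto_const_nhds
  · refine tendsto_nhds_unique (hfs 1) ?_
    simp only [Path.target]
    exact tendsto_const_nhds
  · rintro _ ⟨s, rfl⟩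
    choose z hz hzd using fun k => hnear k P Q s
    refine hK.2.2.2.2.2.1.isClosed.mem_of_tendsto (f := z) (b := Filter.atTop) ?_
      (Filter.Eventually.of_forall hz)
    refine (hfs s).congr_dist ?_
    refine squeeze_zero (fun _ => dist_nonneg) hzd ?_
    simpa using (tendsto_pow_atTop_nhds_zero_of_lt_one hr0 hr1).const_mul 2

lemma edge_points (hS : ¬ ∃ S : Set (ℝ × ℝ), S ⊆ K ∧ Nonempty (S ≃ₜ Circle))
    {P Q : ℝ × ℝ} (hPQ : P ≠ Q) (γ δ : Path P Q) (hγ : range γ ⊆ K) (hδ : range δ ⊆ K)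
    (π ρ : ℝ × ℝ → ℝ) (hρ : Continuous ρ) (c : ℝ)
    (h1 : ∀ s, π (γ s) ≤ c) (h2 : ∀ s, c ≤ π (δ s)) (y : ℝ) (hy : y ∈ Icc (ρ P) (ρ Q)) :
    ∃ z ∈ range γ, z ∈ range δ ∧ π z = c ∧ ρ z = y := by
  obtain ⟨α, hα, hαγ⟩ := exists_arc γ hPQ
  have hαδ := arc_subset_path hS hPQ α δ hα (hαγ.trans hγ) hδ
  have hiv := intermediate_value_univ (0 : unitInterval) 1 (hρ.comp α.continuous)
  simp only [Function.comp, α.source, α.target] at hiv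
  obtain ⟨s, hs⟩ := hiv hy
  have m1 : α s ∈ range γ := hαγ ⟨s, rfl⟩
  have m2 : α s ∈ range δ := hαδ ⟨s, rfl⟩
  refine ⟨α s, m1, m2, ?_, hs⟩
  obtain ⟨a, ha⟩ := m1
  obtain ⟨b, hb⟩ := m2
  apply le_antisymm
  · rw [← ha]; exact h1 a
  · rw [← hb]; exact h2 b

lemma IsFractalSquare.step (hK : IsFractalSquare n D K) (hc : IsPreconnected K)
    (hS : ¬ ∃ S : Set (ℝ × ℝ), S ⊆ K ∧ Nonempty (S ≃ₜ Circle))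
    {d d' : ℤ × ℤ} (hd : d ∈ D) (hd' : d' ∈ D) {P Q P' Q' : ℝ × ℝ}
    (hP : P ∈ K) (hQ : Q ∈ K) (hP' : P' ∈ K) (hQ' : Q' ∈ K)
    (eP : pieceMap n d P = pieceMap n d' P') (eQ : pieceMap n d Q = pieceMap n d' Q')
    (hPQ : pieceMap n d P ≠ pieceMap n d Q)
    (π ρ : ℝ × ℝ → ℝ) (hρ : Continuous ρ) (c : ℝ)
    (h1 : ∀ x ∈ K, π (pieceMap n d x) ≤ c) (h2 : ∀ x ∈ K, c ≤ π (pieceMap n d' x)) (y : ℝ)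
    (hy : y ∈ Icc (ρ (pieceMap n d P)) (ρ (pieceMap n d Q))) :
    ∃ a ∈ K, ∃ b ∈ K, π (pieceMap n d a) = c ∧ ρ (pieceMap n d a) = y ∧
      π (pieceMap n d' b) = c ∧ ρ (pieceMap n d' b) = y := by
  obtain ⟨γ, hγ⟩ := hK.exists_path hc hP hQ
  obtain ⟨δ, hδ⟩ := hK.exists_path hc hP' hQ'
  obtain ⟨z, ⟨s, hs⟩, ⟨t, ht⟩, hz1, hz2⟩ := edge_points hS hPQ
    (γ.map (pieceMap_continuous n d)) ((δ.map (pieceMap_continuous n d')).cast eP eQ)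
    (by rintro _ ⟨s, rfl⟩; exact hK.piece_mem hd (hγ ⟨s, rfl⟩))
    (by rintro _ ⟨s, rfl⟩; exact hK.piece_mem hd' (hδ ⟨s, rfl⟩))
    π ρ hρ c (fun s => h1 _ (hγ ⟨s, rfl⟩)) (fun s => h2 _ (hδ ⟨s, rfl⟩)) y hy
  change pieceMap n d (γ s) = z at hs
  change pieceMap n d' (δ t) = z at ht
  exact ⟨γ s, hγ ⟨s, rfl⟩, δ t, hδ ⟨t, rfl⟩, by rw [hs, hz1], by rw [hs, hz2],
    by rw [ht, hz1], by rw [ht, hz2]⟩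

lemma IsFractalSquare.corners (hK : IsFractalSquare n D K)
    (hc00 : (0, 0) ∈ D) (hc10 : ((n : ℤ) - 1, 0) ∈ D)
    (hc01 : (0, (n : ℤ) - 1) ∈ D) (hc11 : ((n : ℤ) - 1, (n : ℤ) - 1) ∈ D) :
    ((0 : ℝ), (0 : ℝ)) ∈ K ∧ ((1 : ℝ), (0 : ℝ)) ∈ K ∧ ((0 : ℝ), (1 : ℝ)) ∈ K ∧
      ((1 : ℝ), (1 : ℝ)) ∈ K := by
  have hn : (n : ℝ) ≠ 0 := by have := hK.two_le; linarith
  refine ⟨hK.fixed_mem hc00 ?_, hK.fixed_mem hc10 ?_, hK.fixed_mem hc01 ?_, hK.fixed_mem hc11 ?_⟩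
  all_goals
    refine Prod.ext ?_ ?_
    · rw [pieceMap_fst]
      simp [hn]
    · rw [pieceMap_snd]
      simp [hn]

lemma IsFractalSquare.horizontal (hK : IsFractalSquare n D K) (hc : IsPreconnected K)
    (hS : ¬ ∃ S : Set (ℝ × ℝ), S ⊆ K ∧ Nonempty (S ≃ₜ Circle))
    (h00 : ((0 : ℝ), (0 : ℝ)) ∈ K) (h10 : ((1 : ℝ), (0 : ℝ)) ∈ K) (h01 : ((0 : ℝ), (1 : ℝ)) ∈ K)
    (h11 : ((1 : ℝ), (1 : ℝ)) ∈ K) {d : ℤ × ℤ} (hd : d ∈ D) (hd' : d + (1, 0) ∈ D)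
    (y : ℝ) (hy : y ∈ Icc (0 : ℝ) 1) : ((0 : ℝ), y) ∈ K ∧ ((1 : ℝ), y) ∈ K := by
  have hn := hK.two_le
  have hn0 : (0 : ℝ) < n := by linarith
  obtain ⟨a, ha, b, hb, e1, e2, e3, e4⟩ := hK.step hc hS hd hd' h10 h11 h00 h01
    (by apply Prod.ext <;> simp [pieceMap_fst, pieceMap_snd, add_comm])
    (by apply Prod.ext <;> simp [pieceMap_fst, pieceMap_snd, add_comm])
    (by
      intro h
      have := congrArg Prod.snd h
      rw [pieceMap_snd, pieceMap_snd, div_left_inj' hn0.ne'] at this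
      simp at this)
    Prod.fst Prod.snd continuous_snd ((d.1 + 1) / n)
    (by
      intro x hx
      have := hK.bounds hx
      rw [pieceMap_fst]
      refine div_le_div_of_nonneg_right ?_ hn0.le
      linarith)
    (by
      intro x hx
      have := hK.bounds hx
      rw [pieceMap_fst]
      refine div_le_div_of_nonneg_right ?_ hn0.le
      push_cast [Prod.fst_add]
      linarith)
    ((y + d.2) / n)
    (by
      rw [pieceMap_snd, pieceMap_snd]
      constructor
      · gcongr; exact hy.1
      · gcongr; exact hy.2)
  rw [pieceMap_fst, div_left_inj' hn0.ne'] at e1 e3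
  rw [pieceMap_snd, div_left_inj' hn0.ne'] at e2 e4
  push_cast [Prod.fst_add, Prod.snd_add] at e1 e2 e3 e4
  constructor
  · convert hb using 1
    apply Prod.ext <;> dsimp only <;> linarith
  · convert ha using 1
    apply Prod.ext <;> dsimp only <;> linarith

lemma IsFractalSquare.vertical (hK : IsFractalSquare n D K) (hc : IsPreconnected K)
    (hS : ¬ ∃ S : Set (ℝ × ℝ), S ⊆ K ∧ Nonempty (S ≃ₜ Circle))
    (h00 : ((0 : ℝ), (0 : ℝ)) ∈ K) (h10 : ((1 : ℝ), (0 : ℝ)) ∈ K) (h01 : ((0 : ℝ), (1 : ℝ)) ∈ K)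
    (h11 : ((1 : ℝ), (1 : ℝ)) ∈ K) {d : ℤ × ℤ} (hd : d ∈ D) (hd' : d + (0, 1) ∈ D)
    (y : ℝ) (hy : y ∈ Icc (0 : ℝ) 1) : (y, (0 : ℝ)) ∈ K ∧ (y, (1 : ℝ)) ∈ K := by
  have hn := hK.two_le
  have hn0 : (0 : ℝ) < n := by linarith
  obtain ⟨a, ha, b, hb, e1, e2, e3, e4⟩ := hK.step hc hS hd hd' h01 h11 h00 h10
    (by apply Prod.ext <;> simp [pieceMap_fst, pieceMap_snd, add_comm])
    (by apply Prod.ext <;> simp [pieceMap_fst, pieceMap_snd, add_comm])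
    (by
      intro h
      have := congrArg Prod.fst h
      rw [pieceMap_fst, pieceMap_fst, div_left_inj' hn0.ne'] at this
      simp at this)
    Prod.snd Prod.fst continuous_fst ((d.2 + 1) / n)
    (by
      intro x hx
      have := hK.bounds hx
      rw [pieceMap_snd]
      refine div_le_div_of_nonneg_right ?_ hn0.le
      linarith)
    (by
      intro x hx
      have := hK.bounds hx
      rw [pieceMap_snd]
      refine div_le_div_of_nonneg_right ?_ hn0.le
      push_cast [Prod.snd_add]
      linarith)
    ((y + d.1) / n)
    (by
      rw [pieceMap_fst, pieceMap_fst]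
      constructor
      · gcongr; exact hy.1
      · gcongr; exact hy.2)
  rw [pieceMap_snd, div_left_inj' hn0.ne'] at e1 e3
  rw [pieceMap_fst, div_left_inj' hn0.ne'] at e2 e4
  push_cast [Prod.fst_add, Prod.snd_add] at e1 e2 e3 e4
  constructor
  · convert hb using 1
    apply Prod.ext <;> dsimp only <;> linarith
  · convert ha using 1
    apply Prod.ext <;> dsimp only <;> linarith

lemma IsFractalSquare.digit_of_left (hK : IsFractalSquare n D K)
    (h : ∀ y ∈ Icc (0 : ℝ) 1, ((0 : ℝ), y) ∈ K) : ((0 : ℤ), (1 : ℤ)) ∈ D := by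
  have hn := hK.two_le
  have hn0 : (0 : ℝ) < n := by linarith
  obtain ⟨d, hd, x, hx, e⟩ := hK.exists_piece (h ((3 / 2) / n)
    ⟨by positivity, by rw [div_le_one hn0]; linarith⟩)
  have e1 := congrArg Prod.fst e
  have e2 := congrArg Prod.snd e
  rw [pieceMap_fst, div_eq_iff hn0.ne'] at e1
  rw [pieceMap_snd, div_left_inj' hn0.ne'] at e2
  have hb := hK.bounds hx
  have hdd := hK.digit hd
  have a1 : (d.1 : ℝ) < 1 := by linarith
  have a2 : (0 : ℝ) < d.2 := by linarith
  have a3 : (d.2 : ℝ) < 2 := by linarith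
  have a0 := hdd.1
  norm_cast at a0 a1 a2 a3
  convert hd using 1
  apply Prod.ext <;> dsimp only <;> omega

lemma IsFractalSquare.digit_of_bottom (hK : IsFractalSquare n D K)
    (h : ∀ y ∈ Icc (0 : ℝ) 1, (y, (0 : ℝ)) ∈ K) : ((1 : ℤ), (0 : ℤ)) ∈ D := by
  have hn := hK.two_le
  have hn0 : (0 : ℝ) < n := by linarith
  obtain ⟨d, hd, x, hx, e⟩ := hK.exists_piece (h ((3 / 2) / n)
    ⟨by positivity, by rw [div_le_one hn0]; linarith⟩)
  have e1 := congrArg Prod.snd e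
  have e2 := congrArg Prod.fst e
  rw [pieceMap_snd, div_eq_iff hn0.ne'] at e1
  rw [pieceMap_fst, div_left_inj' hn0.ne'] at e2
  have hb := hK.bounds hx
  have hdd := hK.digit hd
  have a1 : (d.2 : ℝ) < 1 := by linarith
  have a2 : (0 : ℝ) < d.1 := by linarith
  have a3 : (d.1 : ℝ) < 2 := by linarith
  have a0 := hdd.2.1
  norm_cast at a0 a1 a2 a3
  convert hd using 1
  apply Prod.ext <;> dsimp only <;> omega

lemma boundary_has_circle
    (hL : ∀ y ∈ Icc (0 : ℝ) 1, ((0 : ℝ), y) ∈ K ∧ ((1 : ℝ), y) ∈ K)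
    (hB : ∀ y ∈ Icc (0 : ℝ) 1, (y, (0 : ℝ)) ∈ K ∧ (y, (1 : ℝ)) ∈ K) :
    ∃ S : Set (ℝ × ℝ), S ⊆ K ∧ Nonempty (S ≃ₜ Circle) := by
  by_contra hS
  let α : Path ((0 : ℝ), (0 : ℝ)) ((0 : ℝ), (1 : ℝ)) :=
    ⟨⟨fun t => ((0 : ℝ), (t : ℝ)), by fun_prop⟩, by simp, by simp⟩
  let bot : Path ((0 : ℝ), (0 : ℝ)) ((1 : ℝ), (0 : ℝ)) :=
    ⟨⟨fun t => ((t : ℝ), (0 : ℝ)), by fun_prop⟩, by simp, by simp⟩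
  let right : Path ((1 : ℝ), (0 : ℝ)) ((1 : ℝ), (1 : ℝ)) :=
    ⟨⟨fun t => ((1 : ℝ), (t : ℝ)), by fun_prop⟩, by simp, by simp⟩
  let top : Path ((0 : ℝ), (1 : ℝ)) ((1 : ℝ), (1 : ℝ)) :=
    ⟨⟨fun t => ((t : ℝ), (1 : ℝ)), by fun_prop⟩, by simp, by simp⟩
  have hsub := arc_subset_path hS (by simp) α ((bot.trans right).trans top.symm)
    (by
      intro s t hst
      exact Subtype.ext (congrArg Prod.snd hst))
    (by rintro _ ⟨t, rfl⟩; exact (hL t t.2).1)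
    (by
      rw [Path.trans_range, Path.trans_range, Path.symm_range]
      rintro _ ((⟨t, rfl⟩ | ⟨t, rfl⟩) | ⟨t, rfl⟩)
      · exact (hB t t.2).1
      · exact (hL t t.2).2
      · exact (hB t t.2).2)
  have hm : ((0 : ℝ), (1 / 2 : ℝ)) ∈ range α :=
    ⟨⟨1 / 2, by norm_num, by norm_num⟩, rfl⟩
  have hm2 := hsub hm
  rw [Path.trans_range, Path.trans_range, Path.symm_range] at hm2
  rcases hm2 with (⟨t, ht⟩ | ⟨t, ht⟩) | ⟨t, ht⟩
  · have : (0 : ℝ) = 1 / 2 := congrArg Prod.snd ht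
    norm_num at this
  · have : (1 : ℝ) = 0 := congrArg Prod.fst ht
    norm_num at this
  · have : (1 : ℝ) = 1 / 2 := congrArg Prod.snd ht
    norm_num at this

end Fractal

/-- If the digit set `D` of a fractal square `K` contains all four
corner digits and some pair of digits of `D` is adjacent horizontally or vertically,
then `K` is not a dendrite. -/
theorem fractalSquare_corners_adjacent_not_dendrite
    (n : ℕ) (D : Set (ℤ × ℤ)) (K : Set (ℝ × ℝ))
    (hK : IsFractalSquare n D K)
    (hc00 : (0, 0) ∈ D) (hc10 : ((n : ℤ) - 1, 0) ∈ D)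
    (hc01 : (0, (n : ℤ) - 1) ∈ D) (hc11 : ((n : ℤ) - 1, (n : ℤ) - 1) ∈ D)
    (hadj : (D ∩ ((· + ((1 : ℤ), (0 : ℤ))) '' D)).Nonempty ∨
      (D ∩ ((· + ((0 : ℤ), (1 : ℤ))) '' D)).Nonempty) :
    ¬ IsDendrite K := by
  rintro ⟨-, -, hconn, -, hS⟩
  have hc := hconn.isPreconnected
  obtain ⟨h00, h10, h01, h11⟩ := hK.corners hc00 hc10 hc01 hc11
  have H := fun (d : ℤ × ℤ) (hd : d ∈ D) (hd' : d + (1, 0) ∈ D) =>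
    hK.horizontal hc hS h00 h10 h01 h11 hd hd'
  have V := fun (d : ℤ × ℤ) (hd : d ∈ D) (hd' : d + (0, 1) ∈ D) =>
    hK.vertical hc hS h00 h10 h01 h11 hd hd'
  rcases hadj with ⟨_, hd', d, hd, rfl⟩ | ⟨_, hd', d, hd, rfl⟩
  · have hL := H d hd hd'
    have hB := V (0, 0) hc00 (by simpa using hK.digit_of_left fun y hy => (hL y hy).1)
    exact hS (boundary_has_circle hL hB)
  · have hB := V d hd hd'
    have hL := H (0, 0) hc00 (by simpa using hK.digit_of_bottom fun y hy => (hB y hy).1)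
    exact hS (boundary_has_circle hL hB)
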